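/- arXiv:math-ph/0007027 — 7 statements merged into one kernel-verified Lean document; each statement's English description precedes it below -/
import Mathlib

section
/- Let a, b ∈ ℂ with a ≠ 0 and c ∈ ℝ, and let P(z) = conj(a)·z⁴ − conj(b)·z³ + c·z² + b·z + a. For every nonzero ζ ∈ ℂ, the multiplicity of ζ as a root of P equals the multiplicity of −1/conj(ζ) as a root of P. In particular, if ζ₀ is a root of P of multiplicity two, then −1/conj(ζ₀) is also a root of multiplicity two, and ζ₀ ≠ −1/conj(ζ₀). -/
open Polynomial

noncomputable def antiT (p : Polynomial ℂ) : Polynomial ℂ :=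
  ((p.map (starRingEnd ℂ)).comp (-X)).reverse

lemma antiT_mul (p q : Polynomial ℂ) : antiT (p * q) = antiT p * antiT q := by
  simp [antiT, reverse_mul_of_domain]

lemma antiT_pow (p : Polynomial ℂ) (n : ℕ) : antiT (p ^ n) = antiT p ^ n := by
  induction n with
  | zero =>
    have h : (1 : Polynomial ℂ).reverse = 1 := by rw [← C_1, reverse_C]
    simp [antiT, h]
  | succ k ih => rw [pow_succ, antiT_mul, ih, pow_succ]

lemma antiT_lin (ζ : ℂ) (h : ζ ≠ 0) :
    antiT (X - C ζ) = C (-(starRingEnd ℂ) ζ) * (X - C (-1 / (starRingEnd ℂ) ζ)) := by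
  have h' : (starRingEnd ℂ) ζ ≠ 0 := by simpa using h
  have e : ((X - C ζ).map (starRingEnd ℂ)).comp (-X)
      = C (-1) * X ^ 1 + C (-(starRingEnd ℂ) ζ) := by
    simp; ring
  have hd : (C (-1) * X ^ 1 + C (-(starRingEnd ℂ) ζ) : Polynomial ℂ).natDegree = 1 := by
    compute_degree!
  rw [antiT, e, reverse, hd, reflect_add, reflect_C_mul_X_pow, reflect_C]
  rw [mul_sub, ← C_mul]
  have : -(starRingEnd ℂ) ζ * (-1 / (starRingEnd ℂ) ζ) = 1 := by field_simp
  rw [this]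
  simp [revAt_le]
  ring

lemma antiT_quartic (a b : ℂ) (ha : a ≠ 0) (c : ℝ) :
    antiT (C ((starRingEnd ℂ) a) * X ^ 4 - C ((starRingEnd ℂ) b) * X ^ 3
      + C (c : ℂ) * X ^ 2 + C b * X + C a) = C ((starRingEnd ℂ) a) * X ^ 4
      - C ((starRingEnd ℂ) b) * X ^ 3 + C (c : ℂ) * X ^ 2 + C b * X + C a := by
  have e : ((C ((starRingEnd ℂ) a) * X ^ 4 - C ((starRingEnd ℂ) b) * X ^ 3
      + C (c : ℂ) * X ^ 2 + C b * X + C a).map (starRingEnd ℂ)).comp (-X)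
      = C a * X ^ 4 + C b * X ^ 3 + C (c : ℂ) * X ^ 2 + C (-(starRingEnd ℂ) b) * X ^ 1
        + C ((starRingEnd ℂ) a) := by
    simp; ring
  have hd : (C a * X ^ 4 + C b * X ^ 3 + C (c : ℂ) * X ^ 2 + C (-(starRingEnd ℂ) b) * X ^ 1
        + C ((starRingEnd ℂ) a) : Polynomial ℂ).natDegree = 4 := by
    compute_degree!
  rw [antiT, e, reverse, hd]
  simp only [reflect_add, reflect_C_mul_X_pow, reflect_C]
  simp [revAt_le]
  ring

lemma antiT_le (P : Polynomial ℂ) (h0 : P ≠ 0) (hT : antiT P = P) (ζ : ℂ) (h : ζ ≠ 0) :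
    rootMultiplicity ζ P ≤ rootMultiplicity (-1 / (starRingEnd ℂ) ζ) P := by
  rw [le_rootMultiplicity_iff h0]
  obtain ⟨q, hq⟩ := pow_rootMultiplicity_dvd P ζ
  have := congrArg antiT hq
  rw [hT, antiT_mul, antiT_pow, antiT_lin ζ h, mul_pow] at this
  exact ⟨C (-(starRingEnd ℂ) ζ) ^ rootMultiplicity ζ P *
    antiT q, by rw [← mul_assoc, mul_comm (_ ^ _) (C _ ^ _)]; exact this⟩

/-- For `P(z) = conj(a)·z⁴ − conj(b)·z³ + c·z² + b·z + a` with `a ≠ 0`, `c ∈ ℝ`: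
the root multiplicity of any nonzero `ζ` equals that of `−1/conj(ζ)`; in particular a
double root `ζ₀` yields a double root `−1/conj(ζ₀)` distinct from `ζ₀`. -/
theorem quartic_rootMultiplicity_antipodal (a b : ℂ) (ha : a ≠ 0) (c : ℝ)
    (P : Polynomial ℂ)
    (hP : P = C ((starRingEnd ℂ) a) * X ^ 4 - C ((starRingEnd ℂ) b) * X ^ 3
      + C (c : ℂ) * X ^ 2 + C b * X + C a) :
    (∀ ζ : ℂ, ζ ≠ 0 →
      rootMultiplicity ζ P = rootMultiplicity (-1 / (starRingEnd ℂ) ζ) P) ∧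
    (∀ ζ₀ : ℂ, rootMultiplicity ζ₀ P = 2 →
      rootMultiplicity (-1 / (starRingEnd ℂ) ζ₀) P = 2 ∧
        ζ₀ ≠ -1 / (starRingEnd ℂ) ζ₀) := by
  have h0 : P.eval 0 ≠ 0 := by simpa [hP] using ha
  have hP0 : P ≠ 0 := by rintro h; simp [h] at h0
  have hT : antiT P = P := by rw [hP]; exact antiT_quartic a b ha c
  have key : ∀ ζ : ℂ, ζ ≠ 0 →
      rootMultiplicity ζ P = rootMultiplicity (-1 / (starRingEnd ℂ) ζ) P := by
    intro ζ hζ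
    have hζ' : (starRingEnd ℂ) ζ ≠ 0 := by simpa using hζ
    refine le_antisymm (antiT_le P hP0 hT ζ hζ) ?_
    have := antiT_le P hP0 hT (-1 / (starRingEnd ℂ) ζ) (div_ne_zero (by norm_num) hζ')
    have e : -1 / (starRingEnd ℂ) (-1 / (starRingEnd ℂ) ζ) = ζ := by
      simp
    rwa [e] at this
  refine ⟨key, fun ζ h2 => ?_⟩
  have hζ : ζ ≠ 0 := by
    rintro rfl
    rw [rootMultiplicity_eq_zero h0] at h2
    omega
  refine ⟨(key ζ hζ).symm.trans h2, fun h => ?_⟩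
  have hζ' : (starRingEnd ℂ) ζ ≠ 0 := by simpa using hζ
  rw [eq_div_iff hζ', Complex.mul_conj] at h
  have h3 : Complex.normSq ζ = -1 := by exact_mod_cast h
  linarith [Complex.normSq_nonneg ζ]
end

section
/- Let a, b ∈ ℂ, c ∈ ℝ, and P(z) = conj(a)·z⁴ − conj(b)·z³ + c·z² + b·z + a. Let α, β ∈ ℂ with (α, β) ≠ (0, 0), and define the transformed quartic Q(ζ) = (conj(β)·ζ − conj(α))⁴ · P( (αζ + β) / (conj(β)·ζ − conj(α)) ) (interpreted by polynomial substitution, i.e. Q(ζ) = Σₖ aₖ (αζ+β)ᵏ (conj(β)ζ − conj(α))^{4−k} where aₖ are the coefficients of P). Then Q again has the form Q(ζ) = conj(a′)·ζ⁴ − conj(b′)·ζ³ + c′·ζ² + b′·ζ + a′ for some a′, b′ ∈ ℂ and c′ ∈ ℝ. -/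
/-- A Möbius substitution `z = (αζ+β)/(conj(β)ζ − conj(α))` (performed by polynomial
substitution) transforms a conjugate-reciprocal quartic
`P(z) = conj(a)z⁴ − conj(b)z³ + cz² + bz + a` (with `c` real) into a quartic of the
same conjugate-reciprocal form. -/
theorem quartic_sigma_form_preserved (a b : ℂ) (c : ℝ) (α β : ℂ)
    (hαβ : (α, β) ≠ (0, 0)) (Q : ℂ → ℂ)
    (hQ : ∀ ζ : ℂ, Q ζ =
      (starRingEnd ℂ) a * (α * ζ + β) ^ 4
      - (starRingEnd ℂ) b * (α * ζ + β) ^ 3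
          * ((starRingEnd ℂ) β * ζ - (starRingEnd ℂ) α)
      + (c : ℂ) * (α * ζ + β) ^ 2
          * ((starRingEnd ℂ) β * ζ - (starRingEnd ℂ) α) ^ 2
      + b * (α * ζ + β) * ((starRingEnd ℂ) β * ζ - (starRingEnd ℂ) α) ^ 3
      + a * ((starRingEnd ℂ) β * ζ - (starRingEnd ℂ) α) ^ 4) :
    ∃ (a' b' : ℂ) (c' : ℝ), ∀ ζ : ℂ,
      Q ζ = (starRingEnd ℂ) a' * ζ ^ 4 - (starRingEnd ℂ) b' * ζ ^ 3
        + (c' : ℂ) * ζ ^ 2 + b' * ζ + a' := by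
  obtain ⟨c', hc'⟩ : ∃ r : ℝ, 6 * (starRingEnd ℂ) a * α ^ 2 * β ^ 2
      + (starRingEnd ℂ) b * (3 * α ^ 2 * β * (starRingEnd ℂ) α
          - 3 * α * β ^ 2 * (starRingEnd ℂ) β)
      + (c : ℂ) * (α ^ 2 * (starRingEnd ℂ) α ^ 2
          - 4 * α * β * (starRingEnd ℂ) α * (starRingEnd ℂ) β
          + β ^ 2 * (starRingEnd ℂ) β ^ 2)
      + b * (3 * α * (starRingEnd ℂ) β * (starRingEnd ℂ) α ^ 2
          - 3 * β * (starRingEnd ℂ) β ^ 2 * (starRingEnd ℂ) α)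
      + 6 * a * (starRingEnd ℂ) β ^ 2 * (starRingEnd ℂ) α ^ 2 = (r : ℂ) := by
    apply Complex.conj_eq_iff_real.mp
    simp only [map_add, map_sub, map_mul, map_pow, Complex.conj_conj, Complex.conj_ofReal,
      map_ofNat]
    ring
  refine ⟨(starRingEnd ℂ) a * β ^ 4 + (starRingEnd ℂ) b * β ^ 3 * (starRingEnd ℂ) α
      + (c : ℂ) * β ^ 2 * (starRingEnd ℂ) α ^ 2 - b * β * (starRingEnd ℂ) α ^ 3
      + a * (starRingEnd ℂ) α ^ 4,
    4 * (starRingEnd ℂ) a * α * β ^ 3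
      + (starRingEnd ℂ) b * (3 * α * β ^ 2 * (starRingEnd ℂ) α - β ^ 3 * (starRingEnd ℂ) β)
      + (c : ℂ) * (2 * α * β * (starRingEnd ℂ) α ^ 2
          - 2 * β ^ 2 * (starRingEnd ℂ) α * (starRingEnd ℂ) β)
      + b * (3 * β * (starRingEnd ℂ) β * (starRingEnd ℂ) α ^ 2 - α * (starRingEnd ℂ) α ^ 3)
      - 4 * a * (starRingEnd ℂ) β * (starRingEnd ℂ) α ^ 3, c', fun ζ => ?_⟩
  rw [hQ, ← hc']
  simp only [map_add, map_sub, map_mul, map_pow, Complex.conj_conj, Complex.conj_ofReal,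
    map_ofNat]
  ring
end

section
/- Let a, b ∈ ℂ with a ≠ 0 and c ∈ ℝ, and let P(z) = conj(a)·z⁴ − conj(b)·z³ + c·z² + b·z + a. Then there exist α, β ∈ ℂ with (α, β) ≠ (0, 0), a nonzero λ ∈ ℂ, b₀ ∈ ℂ, and c₀ ∈ ℝ such that the transformed polynomial Q(ζ) = Σₖ aₖ (αζ+β)ᵏ (conj(β)ζ − conj(α))^{4−k} (where aₖ are the coefficients of P) satisfies Q(ζ) = λ·( ζ⁴ − conj(b₀)·ζ³ + c₀·ζ² + b₀·ζ + 1 ). -/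
/-- Every conjugate-reciprocal quartic `P(z) = conj(a)z⁴ − conj(b)z³ + cz² + bz + a`
with `a ≠ 0` and `c` real can be brought, by a Möbius substitution
`z = (αζ+β)/(conj(β)ζ − conj(α))` and a nonzero scalar, into the normal form
`ζ⁴ − conj(b₀)ζ³ + c₀ζ² + b₀ζ + 1` with `c₀` real. -/
theorem quartic_normal_form (a b : ℂ) (ha : a ≠ 0) (c : ℝ) :
    ∃ (α β : ℂ), (α, β) ≠ (0, 0) ∧ ∃ lam : ℂ, lam ≠ 0 ∧ ∃ (b₀ : ℂ) (c₀ : ℝ),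
      ∀ ζ : ℂ,
        (starRingEnd ℂ) a * (α * ζ + β) ^ 4
        - (starRingEnd ℂ) b * (α * ζ + β) ^ 3
            * ((starRingEnd ℂ) β * ζ - (starRingEnd ℂ) α)
        + (c : ℂ) * (α * ζ + β) ^ 2
            * ((starRingEnd ℂ) β * ζ - (starRingEnd ℂ) α) ^ 2
        + b * (α * ζ + β) * ((starRingEnd ℂ) β * ζ - (starRingEnd ℂ) α) ^ 3
        + a * ((starRingEnd ℂ) β * ζ - (starRingEnd ℂ) α) ^ 4
      = lam * (ζ ^ 4 - (starRingEnd ℂ) b₀ * ζ ^ 3 + (c₀ : ℂ) * ζ ^ 2 + b₀ * ζ + 1) := by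
  obtain ⟨w, hw⟩ := IsAlgClosed.exists_pow_nat_eq a (n := 4) (by norm_num)
  have hw0 : w ≠ 0 := by
    rintro rfl
    apply ha
    rw [← hw]
    norm_num
  have hwc : (starRingEnd ℂ) w ^ 4 = (starRingEnd ℂ) a := by rw [← hw, map_pow]
  have hc0 : (starRingEnd ℂ) w ≠ 0 := (map_ne_zero _).2 hw0
  refine ⟨w, 0, by simp [hw0], w ^ 4 * (starRingEnd ℂ) w ^ 4,
    mul_ne_zero (pow_ne_zero _ hw0) (pow_ne_zero _ hc0),
    -b / (w ^ 3 * (starRingEnd ℂ) w), c / (Complex.normSq w) ^ 2, ?_⟩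
  intro ζ
  rw [← hwc, ← hw]
  push_cast
  rw [← Complex.mul_conj]
  simp only [map_div₀, map_neg, map_mul, map_pow, Complex.conj_conj, map_zero]
  field_simp
  ring
end

section
/- Let b₀ ∈ ℂ, c₀ ∈ ℝ, and Q(ζ) = ζ⁴ − conj(b₀)·ζ³ + c₀·ζ² + b₀·ζ + 1. If ζ₀ ∈ ℂ is a root of Q of multiplicity at least two, then ζ₀ ≠ 0 and Q(ζ) = (ζ − ζ₀)² · (ζ + 1/conj(ζ₀))², i.e. Q has exactly the two double roots ζ₀ and −1/conj(ζ₀). -/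
open Polynomial

/-- If the normalized conjugate-reciprocal quartic
`Q(ζ) = ζ⁴ − conj(b₀)ζ³ + c₀ζ² + b₀ζ + 1` (with `c₀` real) has a root `ζ₀` of
multiplicity at least two, then `ζ₀ ≠ 0` and
`Q = (ζ − ζ₀)²(ζ + 1/conj(ζ₀))²`. -/
theorem normalized_quartic_double_root_factorization (b₀ : ℂ) (c₀ : ℝ)
    (Q : Polynomial ℂ)
    (hQ : Q = X ^ 4 - C ((starRingEnd ℂ) b₀) * X ^ 3 + C (c₀ : ℂ) * X ^ 2
      + C b₀ * X + 1)
    (ζ₀ : ℂ) (h : 2 ≤ rootMultiplicity ζ₀ Q) :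
    ζ₀ ≠ 0 ∧ Q = (X - C ζ₀) ^ 2 * (X + C (1 / (starRingEnd ℂ) ζ₀)) ^ 2 := by
  have hmonic : Q.Monic := by rw [hQ]; monicity!
  have hdeg : Q.natDegree = 4 := by rw [hQ]; compute_degree!
  have hQ0 : Q ≠ 0 := hmonic.ne_zero
  have hev : ∀ x : ℂ, Q.eval x = x ^ 4 - (starRingEnd ℂ) b₀ * x ^ 3 + (c₀ : ℂ) * x ^ 2
      + b₀ * x + 1 := by intro x; rw [hQ]; simp
  have hdev : ∀ x : ℂ, Q.derivative.eval x = 4 * x ^ 3 - (starRingEnd ℂ) b₀ * (3 * x ^ 2)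
      + (c₀ : ℂ) * (2 * x) + b₀ := by
    intro x; rw [hQ]; simp; ring
  obtain ⟨h1, h2⟩ := (one_lt_rootMultiplicity_iff_isRoot hQ0).1 h
  have h1' : Q.eval ζ₀ = 0 := h1
  have h2' : Q.derivative.eval ζ₀ = 0 := h2
  rw [hev] at h1'
  rw [hdev] at h2'
  have hz : ζ₀ ≠ 0 := by
    rintro rfl
    simp at h1'
  refine ⟨hz, ?_⟩
  have h3 := congrArg (starRingEnd ℂ) h1'
  have h4 := congrArg (starRingEnd ℂ) h2'
  simp only [map_add, map_sub, map_mul, map_pow, map_one, map_zero, map_ofNat,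
    Complex.conj_conj, Complex.conj_ofReal] at h3 h4
  have hw : (starRingEnd ℂ) ζ₀ ≠ 0 := by simpa using hz
  have hne : ζ₀ * (starRingEnd ℂ) ζ₀ + 1 ≠ 0 := by
    rw [Complex.mul_conj]
    have := Complex.normSq_nonneg ζ₀
    exact_mod_cast (by positivity : Complex.normSq ζ₀ + 1 ≠ 0)
  generalize (starRingEnd ℂ) ζ₀ = w at *
  have h5 : Q.eval (-(1 / w)) = 0 := by
    rw [hev]; field_simp; linear_combination h3
  have h6 : Q.derivative.eval (-(1 / w)) = 0 := by
    rw [hdev]; field_simp; linear_combination -4 * h3 + w * h4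
  have h7 : 2 ≤ rootMultiplicity (-(1 / w)) Q :=
    (one_lt_rootMultiplicity_iff_isRoot hQ0).2 ⟨h5, h6⟩
  have d1 : (X - C ζ₀) ^ 2 ∣ Q := (le_rootMultiplicity_iff hQ0).1 h
  have d2 : (X + C (1 / w)) ^ 2 ∣ Q := by
    have := (le_rootMultiplicity_iff hQ0).1 h7
    simpa only [C_neg, sub_neg_eq_add] using this
  have hcop : IsCoprime (X - C ζ₀) (X + C (1 / w)) := by
    have : ζ₀ ≠ -(1 / w) := by
      intro e
      apply hne
      rw [e]; field_simp; ring
    have := isCoprime_X_sub_C_of_isUnit_sub (R := ℂ) (sub_ne_zero.2 this).isUnit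
    simpa only [C_neg, sub_neg_eq_add] using this
  have d := (hcop.pow (m := 2) (n := 2)).mul_dvd d1 d2
  have hm : ((X - C ζ₀) ^ 2 * (X + C (1 / w)) ^ 2).Monic :=
    ((monic_X_sub_C _).pow 2).mul ((monic_X_add_C _).pow 2)
  refine eq_of_monic_of_dvd_of_natDegree_le hm hmonic d ?_
  rw [hdeg, ((monic_X_sub_C _).pow 2).natDegree_mul ((monic_X_add_C _).pow 2)]
  simp [natDegree_pow]
end

section
/- Let b₀ ∈ ℂ, c₀ ∈ ℝ, and Q(ζ) = ζ⁴ − conj(b₀)·ζ³ + c₀·ζ² + b₀·ζ + 1. If ζ₀ ∈ ℂ is a root of Q of multiplicity at least two, then ζ₀ is either real or purely imaginary (i.e. ζ₀ = conj(ζ₀) or ζ₀ = −conj(ζ₀)). -/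
open Polynomial

theorem quartic_elim (b B c z w : ℂ)
    (e1 : z^4 - B*z^3 + c*z^2 + b*z + 1 = 0)
    (e2 : 4*z^3 - 3*B*z^2 + 2*c*z + b = 0)
    (e3 : w^4 - b*w^3 + c*w^2 + B*w + 1 = 0)
    (e4 : 4*w^3 - 3*b*w^2 + 2*c*w + B = 0) :
    (1 + z*w)^4 * ((w - z) * (w + z)) = 0 := by
  linear_combination
    ((-3*z^2)*(w^2*(-3*w^2)-(-w^3)*(2*w))-(2*z)*(w*(-3*w^2)-(-w^3)*1)+1*(w*(2*w)-w^2*1))*e1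
    - ((-z^3)*(w^2*(-3*w^2)-(-w^3)*(2*w))-z^2*(w*(-3*w^2)-(-w^3)*1)+z*(w*(2*w)-w^2*1))*e2
    + ((-z^3)*((2*z)*(-3*w^2)-1*(2*w))-z^2*((-3*z^2)*(-3*w^2)-1*1)+z*((-3*z^2)*(2*w)-(2*z)*1))*e3
    - ((-z^3)*((2*z)*(-w^3)-1*w^2)-z^2*((-3*z^2)*(-w^3)-1*w)+z*((-3*z^2)*w^2-(2*z)*w))*e4

/-- Any root of multiplicity at least two of the normalized conjugate-reciprocal
quartic `Q(ζ) = ζ⁴ − conj(b₀)ζ³ + c₀ζ² + b₀ζ + 1` (with `c₀` real) is either real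
or purely imaginary. -/
theorem normalized_quartic_double_root_real_or_imaginary (b₀ : ℂ) (c₀ : ℝ)
    (Q : Polynomial ℂ)
    (hQ : Q = X ^ 4 - C ((starRingEnd ℂ) b₀) * X ^ 3 + C (c₀ : ℂ) * X ^ 2
      + C b₀ * X + 1)
    (ζ₀ : ℂ) (h : 2 ≤ rootMultiplicity ζ₀ Q) :
    ζ₀ = (starRingEnd ℂ) ζ₀ ∨ ζ₀ = -(starRingEnd ℂ) ζ₀ := by
  have hQ0 : Q ≠ 0 := by
    rintro rfl
    simp at h
  have h2 := (one_lt_rootMultiplicity_iff_isRoot hQ0).1 h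
  obtain ⟨h1, h2⟩ := h2
  subst hQ
  have e1 : ζ₀^4 - (starRingEnd ℂ) b₀*ζ₀^3 + c₀*ζ₀^2 + b₀*ζ₀ + 1 = 0 := by
    simpa [IsRoot.def] using h1
  have e2 : 4*ζ₀^3 - 3*(starRingEnd ℂ) b₀*ζ₀^2 + 2*c₀*ζ₀ + b₀ = 0 := by
    simp [IsRoot.def, derivative_X_pow] at h2
    linear_combination h2
  have e3 := congrArg (starRingEnd ℂ) e1
  have e4 := congrArg (starRingEnd ℂ) e2
  simp only [map_add, map_sub, map_mul, map_pow, map_one, map_zero, map_ofNat,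
    Complex.conj_conj, Complex.conj_ofReal] at e3 e4
  have key := quartic_elim _ _ _ _ _ e1 e2 e3 e4
  have hne : (1 + ζ₀ * (starRingEnd ℂ) ζ₀) ≠ 0 := by
    rw [Complex.mul_conj]
    have := Complex.normSq_nonneg ζ₀
    norm_cast
    positivity
  rcases mul_eq_zero.1 ((mul_eq_zero.1 key).resolve_left (pow_ne_zero 4 hne)) with k | k
  · left
    linear_combination -k
  · right
    linear_combination k
end

section
/- Let b₀ ∈ ℂ, c₀ ∈ ℝ, and Q(ζ) = ζ⁴ − conj(b₀)·ζ³ + c₀·ζ² + b₀·ζ + 1. If Q has a root of multiplicity at least two, then b₀ is either real or purely imaginary. -/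
open Polynomial

/-- If the normalized conjugate-reciprocal quartic
`Q(ζ) = ζ⁴ − conj(b₀)ζ³ + c₀ζ² + b₀ζ + 1` (with `c₀` real) has a root of
multiplicity at least two, then `b₀` is real or purely imaginary. -/
theorem normalized_quartic_double_root_coefficient (b₀ : ℂ) (c₀ : ℝ)
    (Q : Polynomial ℂ)
    (hQ : Q = X ^ 4 - C ((starRingEnd ℂ) b₀) * X ^ 3 + C (c₀ : ℂ) * X ^ 2
      + C b₀ * X + 1)
    (h : ∃ ζ₀ : ℂ, 2 ≤ rootMultiplicity ζ₀ Q) :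
    (starRingEnd ℂ) b₀ = b₀ ∨ (starRingEnd ℂ) b₀ = -b₀ := by
  obtain ⟨a, ha⟩ := h
  obtain ⟨R, hR⟩ := (pow_dvd_pow (X - C a) ha).trans (pow_rootMultiplicity_dvd Q a)
  have e0 : Q.eval a = 0 := by rw [hR]; simp
  have e1 : (derivative Q).eval a = 0 := by rw [hR]; simp [derivative_mul, derivative_pow]
  rw [hQ] at e0 e1
  simp [derivative_mul, derivative_pow] at e0 e1
  have f0 := congrArg (starRingEnd ℂ) e0
  have f1 := congrArg (starRingEnd ℂ) e1
  have c2 : (starRingEnd ℂ) 2 = 2 := map_ofNat _ 2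
  have c3 : (starRingEnd ℂ) 3 = 3 := map_ofNat _ 3
  have c4 : (starRingEnd ℂ) 4 = 4 := map_ofNat _ 4
  simp [c2, c3, c4] at f0 f1
  have hb : (starRingEnd ℂ) ((starRingEnd ℂ) b₀) = b₀ := Complex.conj_conj _
  have hns : a * (starRingEnd ℂ) a ≠ -1 := by
    rw [Complex.mul_conj]
    intro hh
    have h2 : Complex.normSq a = -1 := by exact_mod_cast hh
    linarith [Complex.normSq_nonneg a]
  have ha0 : a ≠ 0 := by
    rintro rfl
    simp at e0
  have hs0 : (starRingEnd ℂ) a ≠ 0 := by simpa using ha0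
  have main : ∀ s B b c : ℂ, s ≠ 0 → a * s ≠ -1 →
      a^4 - B*a^3 + c*a^2 + b*a + 1 = 0 → 4*a^3 - 3*B*a^2 + 2*c*a + b = 0 →
      s^4 - b*s^3 + c*s^2 + B*s + 1 = 0 → 4*s^3 - 3*b*s^2 + 2*c*s + B = 0 →
      a^2 = s^2 ∧ B * s = 2 * (a * s - 1) := by
    intro s B b c hs hns g0 g1 g2 g3
    obtain ⟨w, hw⟩ : ∃ w, w * s = -1 := ⟨-s⁻¹, by field_simp⟩
    have hw0 : w ≠ 0 := by rintro rfl; simp at hw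
    have hs' : s = -w⁻¹ := by field_simp; linear_combination hw
    have k0 : w^4 - B*w^3 + c*w^2 + b*w + 1 = 0 := by
      rw [hs'] at g2; field_simp at g2; linear_combination g2
    have k1 : 4*w^3 - 3*B*w^2 + 2*c*w + b = 0 := by
      have : -4 - 3*b*w - 2*c*w^2 + B*w^3 = 0 := by
        rw [hs'] at g3; field_simp at g3; linear_combination g3
      apply mul_left_cancel₀ hw0
      linear_combination this + 4 * k0
    have hwa : w - a ≠ 0 := by
      intro hh
      apply hns
      linear_combination hw - s * hh
    obtain ⟨p, hp⟩ : ∃ p, p = 2*a - B := ⟨_, rfl⟩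
    obtain ⟨q, hq⟩ : ∃ q, q = c + 2*a*p - a^2 := ⟨_, rfl⟩
    have hB : B = 2*a - p := by linear_combination hp
    have hc : c = q - 2*a*p + a^2 := by linear_combination -hq
    have hbb : b = -2*a*q + a^2*p := by
      rw [hB, hc] at g1; linear_combination g1
    have h1 : a^2*q = 1 := by
      rw [hB, hc, hbb] at g0; linear_combination -g0
    have r0 : w^2 + p*w + q = 0 := by
      apply mul_left_cancel₀ (pow_ne_zero 2 hwa)
      rw [hB, hc, hbb] at k0; linear_combination k0 + h1
    have r1 : 2*w + p = 0 := by
      apply mul_left_cancel₀ (pow_ne_zero 2 hwa)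
      rw [hB, hc, hbb] at k1; linear_combination k1 - 2*(w-a)*r0
    have hp2 : p = -2*w := by linear_combination r1
    have hq2 : q = w^2 := by rw [hp2] at r0; linear_combination r0
    constructor
    · rw [hq2] at h1
      rw [hs']; field_simp; linear_combination h1
    · rw [hB, hp2]; linear_combination 2 * hw
  obtain ⟨m1, m2⟩ := main ((starRingEnd ℂ) a) ((starRingEnd ℂ) b₀) b₀ c₀ hs0 hns
    (by linear_combination e0) (by linear_combination e1)
    (by linear_combination f0) (by linear_combination f1)
  have m3 := congrArg (starRingEnd ℂ) m2
  simp [c2] at m3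
  rcases sq_eq_sq_iff_eq_or_eq_neg.mp m1 with h | h
  · left
    apply mul_right_cancel₀ hs0
    linear_combination m2 - m3 + b₀ * h
  · right
    apply mul_right_cancel₀ hs0
    linear_combination m2 - m3 + b₀ * h
end

section
/- Let b₀ ∈ ℂ, c₀ ∈ ℝ, and Q(ζ) = ζ⁴ − conj(b₀)·ζ³ + c₀·ζ² + b₀·ζ + 1. Then Q has a root of multiplicity at least two if and only if there exists s ∈ ℝ such that either Q(ζ) = (ζ² + s·ζ − 1)² or Q(ζ) = (ζ² + i·s·ζ + 1)². -/
open Polynomial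

/-- The normalized conjugate-reciprocal quartic
`Q(ζ) = ζ⁴ − conj(b₀)ζ³ + c₀ζ² + b₀ζ + 1` (with `c₀` real) has a root of
multiplicity at least two if and only if it is of the form `(ζ² + sζ − 1)²` or
`(ζ² + isζ + 1)²` for some real `s`. -/
theorem normalized_quartic_double_root_iff (b₀ : ℂ) (c₀ : ℝ)
    (Q : Polynomial ℂ)
    (hQ : Q = X ^ 4 - C ((starRingEnd ℂ) b₀) * X ^ 3 + C (c₀ : ℂ) * X ^ 2
      + C b₀ * X + 1) :
    (∃ ζ₀ : ℂ, 2 ≤ rootMultiplicity ζ₀ Q) ↔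
      ∃ s : ℝ, Q = (X ^ 2 + C (s : ℂ) * X - 1) ^ 2 ∨
        Q = (X ^ 2 + C (Complex.I * (s : ℂ)) * X + 1) ^ 2 := by
  have key : ∀ u v : ℂ, (v = 1 ∨ v = -1) → ∃ ζ₀ : ℂ,
      2 ≤ rootMultiplicity ζ₀ ((X ^ 2 + C u * X + C v) ^ 2) := by
    intro u v hv
    have hm : (X ^ 2 + C u * X + C v : ℂ[X]).natDegree = 2 := by compute_degree!
    have hne : (X ^ 2 + C u * X + C v : ℂ[X]) ≠ 0 := by
      intro h
      rw [h] at hm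
      simp at hm
    obtain ⟨z, hz⟩ := IsAlgClosed.exists_root (X ^ 2 + C u * X + C v : ℂ[X])
      (by rw [degree_eq_natDegree hne, hm]; norm_num)
    refine ⟨z, ?_⟩
    rw [le_rootMultiplicity_iff (pow_ne_zero 2 hne)]
    exact pow_dvd_pow_of_dvd (dvd_iff_isRoot.mpr hz) 2
  constructor
  · rintro ⟨a, ha⟩
    have hm : Q.natDegree = 4 := by rw [hQ]; compute_degree!
    have hne : Q ≠ 0 := by
      intro h
      rw [h] at hm
      simp at hm
    obtain ⟨h1, h2⟩ := (one_lt_rootMultiplicity_iff_isRoot hne).mp ha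
    rw [hQ] at h1 h2
    obtain ⟨e, he⟩ : ∃ e, e = (starRingEnd ℂ) b₀ := ⟨_, rfl⟩
    obtain ⟨d, hd⟩ : ∃ d, d = (starRingEnd ℂ) a := ⟨_, rfl⟩
    rw [← he] at h1 h2 hQ
    have hb : (starRingEnd ℂ) e = b₀ := by rw [he]; simp
    have E1 : a ^ 4 - e * a ^ 3 + c₀ * a ^ 2 + b₀ * a + 1 = 0 := by
      simpa [IsRoot] using h1
    have E2 : 4 * a ^ 3 - e * (3 * a ^ 2) + c₀ * (2 * a) + b₀ = 0 := by
      simp [IsRoot] at h2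
      linear_combination h2
    have k2 : (starRingEnd ℂ) 2 = 2 := map_ofNat _ 2
    have k3 : (starRingEnd ℂ) 3 = 3 := map_ofNat _ 3
    have k4 : (starRingEnd ℂ) 4 = 4 := map_ofNat _ 4
    have F1 : d ^ 4 - b₀ * d ^ 3 + c₀ * d ^ 2 + e * d + 1 = 0 := by
      have := congrArg (starRingEnd ℂ) E1
      simpa [← hd, ← he, hb] using this
    have F2 : 4 * d ^ 3 - b₀ * (3 * d ^ 2) + c₀ * (2 * d) + e = 0 := by
      have := congrArg (starRingEnd ℂ) E2
      simpa [k2, k3, k4, ← hd, ← he, hb] using this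
    have hn : 1 + a * d ≠ 0 := by
      rw [hd, Complex.mul_conj]
      have := Complex.normSq_nonneg a
      have h3 : (1 + Complex.normSq a : ℝ) ≠ 0 := by positivity
      exact_mod_cast h3
    obtain ⟨p, hp⟩ : ∃ p, p = 2 * a - e := ⟨_, rfl⟩
    obtain ⟨q, hq⟩ : ∃ q, q = c₀ + 2 * a * p - a ^ 2 := ⟨_, rfl⟩
    have e' : e = 2 * a - p := by linear_combination hp
    have c' : (c₀ : ℂ) = q - 2 * a * p + a ^ 2 := by linear_combination -hq
    have b' : b₀ = a ^ 2 * p - 2 * a * q := by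
      rw [e', c'] at E2
      linear_combination E2
    have q1 : a ^ 2 * q = 1 := by
      rw [e', c', b'] at E1
      linear_combination -E1
    have G1 : 1 - p * d + q * d ^ 2 = 0 := by
      have : (1 + a * d) ^ 2 * (1 - p * d + q * d ^ 2) = 0 := by
        rw [e', c', b'] at F1
        linear_combination F1 + d ^ 4 * q1
      exact (mul_eq_zero.mp this).resolve_left (pow_ne_zero 2 hn)
    have G2 : -p + 2 * q * d = 0 := by
      have : (1 + a * d) ^ 2 * (-p + 2 * q * d) = 0 := by
        rw [e', c', b'] at F2
        linear_combination F2 + 4 * d ^ 3 * q1 - 2 * a * (1 + a * d) * G1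
      exact (mul_eq_zero.mp this).resolve_left (pow_ne_zero 2 hn)
    have q2 : q * d ^ 2 = 1 := by linear_combination d * G2 - G1
    have hq0 : q ≠ 0 := by
      rintro rfl
      simp at q1
    have had : (a - d) * (a + d) = 0 := by
      have : q * ((a - d) * (a + d)) = 0 := by linear_combination q1 - q2
      exact (mul_eq_zero.mp this).resolve_left hq0
    have p' : p = 2 * q * d := by linear_combination -G2
    have ceq : ∀ u v : ℂ, -e = 2 * u → (c₀ : ℂ) = u ^ 2 + 2 * v → b₀ = 2 * u * v → v ^ 2 = 1 →
        Q = (X ^ 2 + C u * X + C v) ^ 2 := by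
      intro u v k1 k2 k3 k4
      have k1' : e = -(2 * u) := by linear_combination -k1
      have k4' : (C v : ℂ[X]) ^ 2 = 1 := by rw [← C_pow, k4, C_1]
      rw [hQ, k1', k2, k3]
      simp only [C_neg, C_mul, C_add, C_pow, C_ofNat]
      linear_combination -k4'
    rcases mul_eq_zero.mp had with h | h
    · have hda : d = a := by linear_combination -h
      rw [hda] at p' hd
      obtain ⟨s, hs⟩ := Complex.conj_eq_iff_real.mp (show (starRingEnd ℂ) (q * a - a) = _ by
        have hqc : (starRingEnd ℂ) q = q := by
          rw [hq, hp, he]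
          have : b₀ = e := by rw [b', e', p']; linear_combination (2 * a) * q1
          rw [← he, map_sub, map_add, map_mul, map_mul, map_sub, map_mul, map_pow, hb, ← hd, this]
          simp [k2]
        rw [map_sub, map_mul, hqc, ← hd])
      refine ⟨s, Or.inl ?_⟩
      rw [ceq s (-1) ?_ ?_ ?_ (by norm_num)]
      · simp [sub_eq_add_neg]
      · rw [← hs, e', p']; ring
      · rw [← hs, c', p']; linear_combination (-q - 2) * q1
      · rw [← hs, b', p']; linear_combination (2 * a) * q1
    · have hda : d = -a := by linear_combination h
      rw [hda] at p' hd
      obtain ⟨s, hs⟩ := Complex.conj_eq_iff_real.mp (show (starRingEnd ℂ) (Complex.I * (q * a + a)) = _ by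
        have hqc : (starRingEnd ℂ) q = q := by
          have : b₀ = -e := by rw [b', e', p']; linear_combination (-2 * a) * q1
          rw [hq, hp]
          rw [map_sub, map_add, map_mul, map_mul, map_sub, map_mul, map_pow, hb, ← hd, this]
          simp [k2]
          ring
        rw [map_mul, map_add, map_mul, hqc, ← hd, Complex.conj_I]
        ring)
      have hI : Complex.I * s = -(q * a + a) := by
        rw [← hs]; linear_combination (q * a + a) * Complex.I_mul_I
      refine ⟨s, Or.inr ?_⟩
      rw [ceq (Complex.I * s) 1 ?_ ?_ ?_ (by norm_num)]
      · simp
      · rw [hI, e', p']; ring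
      · rw [hI, c', p']; linear_combination (-q + 2) * q1
      · rw [hI, b', p']; linear_combination (-2 * a) * q1
  · rintro ⟨s, h | h⟩
    · obtain ⟨z, hz⟩ := key s (-1) (Or.inr rfl)
      refine ⟨z, ?_⟩
      rw [h]
      simpa [sub_eq_add_neg] using hz
    · obtain ⟨z, hz⟩ := key (Complex.I * s) 1 (Or.inl rfl)
      refine ⟨z, ?_⟩
      rw [h]
      simpa using hz
end
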